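/- arXiv:0708.0234 — 2 statements merged into one kernel-verified Lean document; each statement's English description precedes it below -/
import Mathlib

section
/- Let N ∈ ℕ and let C^A_{BC} (A,B,C = 1,…,N) be real constants, antisymmetric in the lower indices, such that the N×N matrices C_A with entries (C_A)^B_C = C^B_{AC} satisfy [C_A, C_B] = Σ_C C^C_{AB} C_C. Let γ = (γ_{AB}) be a real symmetric invertible N×N matrix (inverse γ^{AB}) satisfying γ_{AB} C^B_{CD} + γ_{DB} C^B_{CA} = 0. Let B = (B_{AB}) be a real antisymmetric N×N matrix satisfying Σ_A C^A_{BC} B_{AD} = 0 for all B, C, D. For k ∈ ℝ^N set C(k) := Σ_A k^A C_A, Y(k) := Σ_{j≥0} (−1)^j C(k)^j/(j+1)!, on U := {k : Y(k) invertible} define X_A{}^M(k) by Σ_M Y^B_M(k) X_A{}^M(k) = δ^B_A, and for smooth f : U → ℝ define J_A[f](k) := Σ_M X_A{}^M(k) ∂f/∂k^M (k) − (1/2) Σ_B B_{AB} k^B f(k) and J²[f] := Σ_{A,B} γ^{AB} J_A[J_B[f]]. Then for every smooth f : U → ℝ and every k ∈ U: J_A[J_B[f]] − J_B[J_A[f]]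 = Σ_C C^C_{AB} J_C[f] + B_{AB} f, and J_A[J²[f]] − J²[J_A[f]] = 2 Σ_{B,C} B_{AB} γ^{BC} J_C[f]. -/
open Matrix

/-- The covariant right-invariant vector field
`J_A[f] = Σ_M X_A{}^M ∂f/∂k^M − (1/2) Σ_B B_{AB} k^B f`. -/
noncomputable def covVecFieldOp {N : ℕ} (Xe : (Fin N → ℝ) → Fin N → Fin N → ℝ)
    (B : Matrix (Fin N) (Fin N) ℝ) (A : Fin N)
    (f : (Fin N → ℝ) → ℝ) (k : Fin N → ℝ) : ℝ :=
  (∑ M, Xe k A M * fderiv ℝ f k (Pi.single M 1)) - (1/2 : ℝ) * (∑ B', B A B' * k B') * f k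

/-- The operator `J² = γ^{AB} J_A J_B`. -/
noncomputable def covCasimirOp {N : ℕ} (γinv : Matrix (Fin N) (Fin N) ℝ)
    (Xe : (Fin N → ℝ) → Fin N → Fin N → ℝ) (B : Matrix (Fin N) (Fin N) ℝ)
    (f : (Fin N → ℝ) → ℝ) (k : Fin N → ℝ) : ℝ :=
  ∑ A, ∑ B', γinv A B' * covVecFieldOp Xe B A (covVecFieldOp Xe B B' f) k

section VectorFields

variable {V : Type*} [NormedAddCommGroup V] [NormedSpace ℝ V]

/-- A curve solving a linear ODE and starting at zero vanishes. -/
lemma eq_zero_of_radial_ode {W W' : V → V} {T : V → V →L[ℝ] V}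
    (hW : ∀ k, ∃ D : V →L[ℝ] V, HasFDerivAt W D k ∧ D k = W' k)
    (hT : ∀ (t : ℝ) k, T (t • k) = t • T k)
    (hode : ∀ k, W' k = -T k (W k) - (2 : ℝ) • W k) (k : V) : W k = 0 := by
  have hd : ∀ t : ℝ, HasDerivAt (fun t : ℝ => t ^ 2 • W (t • k))
      (-T k (t ^ 2 • W (t • k))) t := by
    intro t
    obtain ⟨D, hD, hDk⟩ := hW (t • k)
    have h1 : HasDerivAt (fun t : ℝ => t • k) k t := by
      simpa using (hasDerivAt_id t).smul_const k
    have h2 := ((hasDerivAt_id t).pow 2).smul (hD.comp_hasDerivAt t h1)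
    refine h2.congr_deriv ?_
    rw [hode, map_smul, hT] at hDk
    simp only [id, Function.comp, Pi.pow_apply, pow_two, mul_smul, hDk, smul_sub, smul_neg, map_smul,
      _root_.smul_apply]
    module
  have h := eq_zero_of_abs_deriv_le_mul_abs_self_of_eq_zero_right (a := 0) (b := 1)
    (K := ‖T k‖) (f := fun t : ℝ => t ^ 2 • W (t • k))
    (fun t _ => (hd t).continuousAt.continuousWithinAt)
    (fun t _ => (hd t).hasDerivWithinAt) (by simp)
    (fun t _ => by rw [norm_neg]; exact (T k).le_opNorm _) 1 (by simp)
  simpa using h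

/-- The Maurer–Cartan equation for a solution `Y` of `Y + (k·∂)Y = 1 - ad(k) Y`. -/
lemma maurerCartan_of_euler (L : V →L[ℝ] V →L[ℝ] V) (hanti : ∀ a b, L a b = -L b a)
    (hjac : ∀ a b c, L (L a b) c = L a (L b c) - L b (L a c))
    {Y : V → V →L[ℝ] V} (hY : ContDiff ℝ 2 Y)
    (heuler : ∀ k, Y k + fderiv ℝ Y k k = 1 - L k * Y k) (u v k : V) :
    fderiv ℝ Y k u v - fderiv ℝ Y k v u + L (Y k u) (Y k v) = 0 := by
  have hY1 : ∀ k, HasFDerivAt Y (fderiv ℝ Y k) k := fun k =>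
    (hY.differentiable (by norm_num) k).hasFDerivAt
  have hY2 : ∀ k, HasFDerivAt (fderiv ℝ Y) (fderiv ℝ (fderiv ℝ Y) k) k := fun k =>
    ((hY.fderiv_right (m := 1) (by norm_num)).differentiable (by norm_num) k).hasFDerivAt
  have hsymm : ∀ k a b, fderiv ℝ (fderiv ℝ Y) k a b = fderiv ℝ (fderiv ℝ Y) k b a := fun k a b =>
    (hY.contDiffAt.isSymmSndFDerivAt (by simp)).eq a b
  have hE : ∀ k u w, fderiv ℝ (fderiv ℝ Y) k k u w
      = -L u (Y k w) - L k (fderiv ℝ Y k u w) - (2 : ℝ) • fderiv ℝ Y k u w := by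
    intro k u w
    have h1 := (((hY1 k).add ((hY2 k).clm_apply (hasFDerivAt_id k))).clm_apply
      (hasFDerivAt_const w k))
    have h2 : HasFDerivAt (fun k => w - L k (Y k w)) _ k :=
      ((L.hasFDerivAt (x := k)).clm_apply ((hY1 k).clm_apply (hasFDerivAt_const w k))).const_sub w
    have h3 := h1.unique (h2.congr_of_eventuallyEq (Filter.Eventually.of_forall fun q => by
      simpa using congrArg (fun S : V →L[ℝ] V => S w) (heuler q)))
    have h4 := congrArg (fun S : V →L[ℝ] V => S u) h3
    simp at h4
    rw [hsymm k k u, two_smul, ← sub_eq_zero, ← sub_eq_zero.2 h4]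
    abel
  refine eq_zero_of_radial_ode (T := fun k => L k)
    (W := fun k => fderiv ℝ Y k u v - fderiv ℝ Y k v u + L (Y k u) (Y k v))
    (fun k => ⟨_, ((((hY2 k).clm_apply (hasFDerivAt_const u k)).clm_apply
      (hasFDerivAt_const v k)).sub (((hY2 k).clm_apply (hasFDerivAt_const v k)).clm_apply
      (hasFDerivAt_const u k))).add ((L.hasFDerivAt.comp k
        ((hY1 k).clm_apply (hasFDerivAt_const u k))).clm_apply
          ((hY1 k).clm_apply (hasFDerivAt_const v k))), rfl⟩) (by simp) ?_ k
  intro k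
  have e1 : ∀ w, fderiv ℝ Y k k w = w - L k (Y k w) - Y k w := fun w => by
    have := congrArg (fun S : V →L[ℝ] V => S w) (heuler k)
    simp at this
    rw [← this]; abel
  simp [hE, e1, hjac, hanti v (Y k u)]
  module

/-- Commutator of two first-order operators `x·∂ - b/2`. -/
lemma firstOrder_commutator {f : V → ℝ} {x y : V → V} {k : V} (b c : V →L[ℝ] ℝ)
    (hf : ContDiffAt ℝ 2 f k) (hx : DifferentiableAt ℝ x k) (hy : DifferentiableAt ℝ y k) :
    (fderiv ℝ (fun q => fderiv ℝ f q (y q) - 1 / 2 * c q * f q) k (x k)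
        - 1 / 2 * b k * (fderiv ℝ f k (y k) - 1 / 2 * c k * f k))
      - (fderiv ℝ (fun q => fderiv ℝ f q (x q) - 1 / 2 * b q * f q) k (y k)
        - 1 / 2 * c k * (fderiv ℝ f k (x k) - 1 / 2 * b k * f k))
      = fderiv ℝ f k (fderiv ℝ y k (x k) - fderiv ℝ x k (y k))
        - 1 / 2 * (c (x k) - b (y k)) * f k := by
  have h1 : HasFDerivAt f (fderiv ℝ f k) k := (hf.differentiableAt (by norm_num)).hasFDerivAt
  have h2 : HasFDerivAt (fderiv ℝ f) (fderiv ℝ (fderiv ℝ f) k) k :=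
    ((hf.fderiv_right (m := 1) (by norm_num)).differentiableAt (by norm_num)).hasFDerivAt
  have hs := (hf.isSymmSndFDerivAt (by simp)).eq (x k) (y k)
  have key : ∀ (z : V → V) (d : V →L[ℝ] ℝ), DifferentiableAt ℝ z k →
      HasFDerivAt (fun q => fderiv ℝ f q (z q) - 1 / 2 * d q * f q) _ k := fun z d hz =>
    (h2.clm_apply hz.hasFDerivAt).sub ((d.hasFDerivAt.const_mul (1 / 2)).mul h1)
  rw [(key y c hy).fderiv, (key x b hx).fderiv]
  simp [hs]
  ring

end VectorFields

lemma hasSum_submatrix {ι m n : Type*} {f : ι → Matrix m m ℝ} {A : Matrix m m ℝ}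
    (h : HasSum f A) (r c : n → m) :
    HasSum (fun i => (f i).submatrix r c) (A.submatrix r c) :=
  Pi.hasSum.2 fun p => Pi.hasSum.2 fun q => Pi.hasSum.1 (Pi.hasSum.1 h (r p)) (c q)

section ExpQuot

open scoped Matrix.Norms.Operator Nat

/-- The upper right block of a block matrix, as a continuous linear map. -/
noncomputable def upperRight {n : Type*} [Fintype n] : Matrix (n ⊕ n) (n ⊕ n) ℝ →L[ℝ] Matrix n n ℝ :=
  LinearMap.toContinuousLinearMap
    { toFun := toBlocks₁₂, map_add' := fun _ _ => rfl, map_smul' := fun _ _ => rfl }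

@[simp] lemma upperRight_apply {n : Type*} [Fintype n] (A : Matrix (n ⊕ n) (n ⊕ n) ℝ) :
    upperRight A = A.toBlocks₁₂ := rfl

variable {n : Type*} [Fintype n] [DecidableEq n]

/-- The matrix `(1 - exp (-X)) / X`, defined by its power series. -/
noncomputable def expQuot (X : Matrix n n ℝ) : Matrix n n ℝ :=
  ∑' j : ℕ, ((-1 : ℝ) ^ j / (Nat.factorial (j + 1))) • X ^ j

lemma fromBlocks_pow_succ (X : Matrix n n ℝ) (a : ℝ) (j : ℕ) :
    (fromBlocks (-X) (a • 1) 0 0 : Matrix (n ⊕ n) (n ⊕ n) ℝ) ^ (j + 1)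
      = fromBlocks ((-X) ^ (j + 1)) (a • (-X) ^ j) 0 0 := by
  induction j with
  | zero => simp
  | succ j ih =>
    rw [pow_succ', ih, fromBlocks_multiply, pow_succ' (-X) (j + 1), pow_succ' (-X) j]
    simp

lemma exp_fromBlocks₂₂ (X : Matrix n n ℝ) (a : ℝ) :
    (NormedSpace.exp (fromBlocks (-X) (a • 1) 0 0 : Matrix (n ⊕ n) (n ⊕ n) ℝ)).toBlocks₂₂ = 1 := by
  have h := NormedSpace.exp_series_hasSum_exp' (𝕂 := ℝ)
    (fromBlocks (-X) (a • 1) 0 0 : Matrix (n ⊕ n) (n ⊕ n) ℝ)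
  have h' := hasSum_submatrix h Sum.inr Sum.inr
  refine (h'.unique (hasSum_single 0 ?_)).trans ?_
  · rintro (_ | j) hj
    · exact absurd rfl hj
    · rw [fromBlocks_pow_succ]; ext; simp
  · ext i j; simp [Matrix.one_apply]

lemma hasSum_exp_fromBlocks₁₂ (X : Matrix n n ℝ) (a : ℝ) :
    HasSum (fun j : ℕ => a • ((-1 : ℝ) ^ j / (Nat.factorial (j + 1))) • X ^ j)
      (NormedSpace.exp (fromBlocks (-X) (a • 1) 0 0 : Matrix (n ⊕ n) (n ⊕ n) ℝ)).toBlocks₁₂ := by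
  have h := NormedSpace.exp_series_hasSum_exp' (𝕂 := ℝ)
    (fromBlocks (-X) (a • 1) 0 0 : Matrix (n ⊕ n) (n ⊕ n) ℝ)
  have h' := (hasSum_nat_add_iff' 1).2 (hasSum_submatrix h Sum.inl Sum.inr)
  convert! h' using 1
  · ext j p q
    rw [fromBlocks_pow_succ, ← neg_one_smul ℝ X]
    simp only [smul_pow, Matrix.smul_apply, submatrix_apply, fromBlocks_apply₁₂, smul_eq_mul]
    ring
  · ext p q; simp [toBlocks₁₂]; rfl

lemma hasSum_expQuot (X : Matrix n n ℝ) :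
    HasSum (fun j : ℕ => ((-1 : ℝ) ^ j / (Nat.factorial (j + 1))) • X ^ j) (expQuot X) := by
  have h := (hasSum_exp_fromBlocks₁₂ X 1).summable
  simp only [one_smul] at h
  exact h.hasSum

lemma mul_expQuot_of_mul_eq_zero {B X : Matrix n n ℝ} (h : B * X = 0) : B * expQuot X = B := by
  refine ((hasSum_expQuot X).mul_left B).unique ?_
  convert! hasSum_single (f := fun j : ℕ => B * ((-1 : ℝ) ^ j / (Nat.factorial (j + 1))) • X ^ j)
    0 ?_ using 1
  · simp
  · rintro (_ | j) hj
    · exact absurd rfl hj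
    · rw [mul_smul_comm, pow_succ' X, ← mul_assoc, h, zero_mul, smul_zero]

lemma exp_fromBlocks₁₂ (X : Matrix n n ℝ) (a : ℝ) :
    (NormedSpace.exp (fromBlocks (-X) (a • 1) 0 0 : Matrix (n ⊕ n) (n ⊕ n) ℝ)).toBlocks₁₂
      = a • expQuot X := by
  exact (hasSum_exp_fromBlocks₁₂ X a).unique ((hasSum_expQuot X).const_smul a)

lemma expQuot_eq (X : Matrix n n ℝ) : expQuot X
    = (NormedSpace.exp (fromBlocks (-X) 1 0 0 : Matrix (n ⊕ n) (n ⊕ n) ℝ)).toBlocks₁₂ := by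
  simpa using (exp_fromBlocks₁₂ X 1).symm

lemma contDiff_expQuot : ContDiff ℝ (⊤ : ℕ∞) (expQuot : Matrix n n ℝ → Matrix n n ℝ) := by
  let Q : Matrix n n ℝ →ₗ[ℝ] Matrix (n ⊕ n) (n ⊕ n) ℝ :=
    { toFun := fun X => fromBlocks (-X) 0 0 0
      map_add' := fun X Y => by simp [fromBlocks_add, add_comm]
      map_smul' := fun c X => by simp [fromBlocks_smul] }
  have hexp : ContDiff ℝ (⊤ : ℕ∞)
      (NormedSpace.exp : Matrix (n ⊕ n) (n ⊕ n) ℝ → Matrix (n ⊕ n) (n ⊕ n) ℝ) :=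
    contDiff_iff_contDiffAt.2 fun X => (NormedSpace.exp_analytic (𝕂 := ℝ) X).contDiffAt
  have h : (expQuot : Matrix n n ℝ → Matrix n n ℝ) = fun X => upperRight
      (NormedSpace.exp (Q.toContinuousLinearMap X + fromBlocks 0 1 0 0)) := by
    funext X
    rw [expQuot_eq]
    simp [Q, fromBlocks_add]
  rw [h]
  exact upperRight.contDiff.comp
    (hexp.comp (Q.toContinuousLinearMap.contDiff.add contDiff_const))

lemma expQuot_euler (X : Matrix n n ℝ) :
    expQuot X + fderiv ℝ expQuot X X = 1 - X * expQuot X := by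
  set M : Matrix (n ⊕ n) (n ⊕ n) ℝ := fromBlocks (-X) 1 0 0 with hM
  have hsmul : ∀ t : ℝ, t • M = fromBlocks (-(t • X)) (t • 1) 0 0 := fun t => by
    simp [hM, fromBlocks_smul]
  have h1 : HasDerivAt (fun t : ℝ => t • expQuot (t • X))
      (upperRight (M * NormedSpace.exp ((1 : ℝ) • M))) 1 := by
    refine (upperRight.hasFDerivAt.comp_hasDerivAt (1 : ℝ)
      (hasDerivAt_exp_smul_const' M (1 : ℝ))).congr_of_eventuallyEq
      (Filter.Eventually.of_forall fun t => ?_)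
    simp only [Function.comp, hsmul]
    exact (exp_fromBlocks₁₂ _ _).symm
  have hd : HasDerivAt (fun t : ℝ => t • X) X 1 := by
    have := (hasDerivAt_id (1 : ℝ)).smul_const X
    rwa [one_smul] at this
  have hf : HasFDerivAt expQuot (fderiv ℝ expQuot X) ((1 : ℝ) • X) := by
    rw [one_smul]
    exact (contDiff_expQuot.differentiable (by simp) X).hasFDerivAt
  have h2 := (hasDerivAt_id (1 : ℝ)).smul (hf.comp_hasDerivAt (1 : ℝ) hd)
  have h3 := h2.unique h1
  have h4 : upperRight (M * NormedSpace.exp M) = 1 - X * expQuot X := by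
    have h5 := exp_fromBlocks₂₂ X 1
    rw [expQuot_eq, ← hM]
    rw [one_smul, ← hM] at h5
    conv_lhs => rw [← fromBlocks_toBlocks (NormedSpace.exp M), h5, hM, fromBlocks_multiply]
    simp
    abel
  have e : (1 : ℝ) • M = M := one_smul ℝ M
  rw [e, h4] at h3
  rw [← h3, add_comm]
  simp
  rfl

end ExpQuot
section Frame

open scoped Matrix.Norms.Operator

variable {N : ℕ}

/-- The action of square matrices on vectors. -/
noncomputable def mulVecCLM :
    Matrix (Fin N) (Fin N) ℝ →L[ℝ] (Fin N → ℝ) →L[ℝ] (Fin N → ℝ) :=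
  LinearMap.toContinuousLinearMap
    (Matrix.toLin'.trans LinearMap.toContinuousLinearMap).toLinearMap

@[simp] lemma mulVecCLM_apply (A : Matrix (Fin N) (Fin N) ℝ) (v : Fin N → ℝ) :
    mulVecCLM A v = A *ᵥ v := rfl

/-- The matrix `Σ_A k^A C_A`. -/
noncomputable def matComb (CM : Fin N → Matrix (Fin N) (Fin N) ℝ) :
    (Fin N → ℝ) →L[ℝ] Matrix (Fin N) (Fin N) ℝ :=
  LinearMap.toContinuousLinearMap (Fintype.linearCombination ℝ CM)

lemma matComb_apply (CM : Fin N → Matrix (Fin N) (Fin N) ℝ) (k : Fin N → ℝ) :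
    matComb CM k = ∑ A, k A • CM A := rfl

lemma maurerCartan_expQuot (CM : Fin N → Matrix (Fin N) (Fin N) ℝ)
    (hanti : ∀ a b, matComb CM a *ᵥ b = -(matComb CM b *ᵥ a))
    (hjac : ∀ a b, matComb CM (matComb CM a *ᵥ b)
      = matComb CM a * matComb CM b - matComb CM b * matComb CM a) (u v k : Fin N → ℝ) :
    fderiv ℝ (fun q => mulVecCLM (expQuot (matComb CM q))) k u v
      - fderiv ℝ (fun q => mulVecCLM (expQuot (matComb CM q))) k v u
      + matComb CM (expQuot (matComb CM k) *ᵥ u) *ᵥ (expQuot (matComb CM k) *ᵥ v) = 0 := by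
  refine maurerCartan_of_euler (mulVecCLM ∘L matComb CM) (fun a b => hanti a b) (fun a b c => ?_)
    (Y := fun q => mulVecCLM (expQuot (matComb CM q))) ?_ (fun k => ?_) u v k
  · simp [hjac]
  · exact mulVecCLM.contDiff.comp
      ((contDiff_expQuot.of_le (WithTop.coe_le_coe.2 le_top)).comp (matComb CM).contDiff)
  · have h : HasFDerivAt (fun q => mulVecCLM (expQuot (matComb CM q)))
        (mulVecCLM ∘L (fderiv ℝ expQuot (matComb CM k)) ∘L matComb CM) k :=
      mulVecCLM.hasFDerivAt.comp k
        (((contDiff_expQuot.differentiable (by simp) _).hasFDerivAt).comp k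
          (matComb CM).hasFDerivAt)
    rw [h.fderiv]
    ext1 w
    have := congrArg (fun A => A *ᵥ w) (expQuot_euler (matComb CM k))
    simpa [add_mulVec, sub_mulVec] using this

lemma contDiffAt_expQuot_inv_mulVec (CM : Fin N → Matrix (Fin N) (Fin N) ℝ) {k : Fin N → ℝ}
    (hk : IsUnit (expQuot (matComb CM k))) (a : Fin N → ℝ) :
    ContDiffAt ℝ (⊤ : ℕ∞) (fun q => (expQuot (matComb CM q))⁻¹ *ᵥ a) k := by
  simp only [Matrix.nonsing_inv_eq_ringInverse]
  obtain ⟨w, hw⟩ := hk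
  have h1 : ContDiffAt ℝ (⊤ : ℕ∞) Ring.inverse (expQuot (matComb CM k)) :=
    hw ▸ contDiffAt_ringInverse ℝ w
  have h2 : ContDiffAt ℝ (⊤ : ℕ∞) (fun q => expQuot (matComb CM q)) k :=
    (contDiff_expQuot.comp (matComb CM).contDiff).contDiffAt
  exact (mulVecCLM.contDiff.contDiffAt.comp k (h1.comp k h2)).clm_apply contDiffAt_const

lemma isOpen_isUnit_expQuot (CM : Fin N → Matrix (Fin N) (Fin N) ℝ) :
    IsOpen {k | IsUnit (expQuot (matComb CM k))} :=
  Units.isOpen.preimage (contDiff_expQuot.continuous.comp (matComb CM).continuous)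

lemma bracket_expQuot_inv_mulVec (CM : Fin N → Matrix (Fin N) (Fin N) ℝ)
    (hanti : ∀ a b, matComb CM a *ᵥ b = -(matComb CM b *ᵥ a))
    (hjac : ∀ a b, matComb CM (matComb CM a *ᵥ b)
      = matComb CM a * matComb CM b - matComb CM b * matComb CM a) {k : Fin N → ℝ}
    (hk : IsUnit (expQuot (matComb CM k))) (a b : Fin N → ℝ) :
    fderiv ℝ (fun q => (expQuot (matComb CM q))⁻¹ *ᵥ b) k ((expQuot (matComb CM k))⁻¹ *ᵥ a)
      - fderiv ℝ (fun q => (expQuot (matComb CM q))⁻¹ *ᵥ a) k ((expQuot (matComb CM k))⁻¹ *ᵥ b)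
      = (expQuot (matComb CM k))⁻¹ *ᵥ (matComb CM a *ᵥ b) := by
  have hinv : ∀ {q}, IsUnit (expQuot (matComb CM q)) → ∀ a,
      expQuot (matComb CM q) *ᵥ ((expQuot (matComb CM q))⁻¹ *ᵥ a) = a := fun hq a => by
    rw [mulVec_mulVec, mul_nonsing_inv _ ((isUnit_iff_isUnit_det _).1 hq), one_mulVec]
  have hY : DifferentiableAt ℝ (fun q => mulVecCLM (expQuot (matComb CM q))) k :=
    (mulVecCLM.contDiff.comp (contDiff_expQuot.comp (matComb CM).contDiff)).differentiable
      (by simp) k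
  have hx : ∀ a u, fderiv ℝ (fun q => mulVecCLM (expQuot (matComb CM q))) k u
        ((expQuot (matComb CM k))⁻¹ *ᵥ a)
      + expQuot (matComb CM k) *ᵥ (fderiv ℝ (fun q => (expQuot (matComb CM q))⁻¹ *ᵥ a) k u)
      = 0 := by
    intro a u
    have h1 := hY.hasFDerivAt.clm_apply
      ((contDiffAt_expQuot_inv_mulVec CM hk a).differentiableAt (by simp)).hasFDerivAt
    have h2 := h1.unique ((hasFDerivAt_const a k).congr_of_eventuallyEq
      (((isOpen_isUnit_expQuot CM).eventually_mem hk).mono fun q hq => hinv hq a))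
    have h3 := congrArg (fun S : (Fin N → ℝ) →L[ℝ] (Fin N → ℝ) => S u) h2
    simpa [add_comm] using h3
  have hmc := maurerCartan_expQuot CM hanti hjac ((expQuot (matComb CM k))⁻¹ *ᵥ a)
    ((expQuot (matComb CM k))⁻¹ *ᵥ b) k
  rw [hinv hk, hinv hk] at hmc
  have ha := hx a ((expQuot (matComb CM k))⁻¹ *ᵥ b)
  have hb := hx b ((expQuot (matComb CM k))⁻¹ *ᵥ a)
  apply mulVec_injective_of_isUnit hk
  simp only [mulVec_sub, hinv hk]
  rw [← sub_eq_zero]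
  linear_combination (norm := module) hb - ha - hmc

end Frame
section Operators

variable {N : ℕ}

/-- The linear form `k ↦ Σ_B B_{AB} k^B`. -/
noncomputable def rowForm (B : Matrix (Fin N) (Fin N) ℝ) (A : Fin N) : (Fin N → ℝ) →L[ℝ] ℝ :=
  (ContinuousLinearMap.proj A).comp (mulVecCLM B)

lemma covVecFieldOp_eq (Xe : (Fin N → ℝ) → Fin N → Fin N → ℝ) (B : Matrix (Fin N) (Fin N) ℝ)
    (A : Fin N) (f : (Fin N → ℝ) → ℝ) (k : Fin N → ℝ) :
    covVecFieldOp Xe B A f k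
      = fderiv ℝ f k (fun M => Xe k A M) - 1 / 2 * rowForm B A k * f k := by
  have h : (∑ M, Xe k A M * fderiv ℝ f k (Pi.single M 1)) = fderiv ℝ f k (fun M => Xe k A M) := by
    conv_rhs => rw [pi_eq_sum_univ' (fun M => Xe k A M), map_sum]
    simp
  rw [covVecFieldOp, h]
  rfl

lemma covVecFieldOp_congr {Xe : (Fin N → ℝ) → Fin N → Fin N → ℝ} {B : Matrix (Fin N) (Fin N) ℝ}
    {U : Set (Fin N → ℝ)} (hU : IsOpen U) (A : Fin N) {f g : (Fin N → ℝ) → ℝ}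
    (h : Set.EqOn f g U) : Set.EqOn (covVecFieldOp Xe B A f) (covVecFieldOp Xe B A g) U := by
  intro k hk
  rw [covVecFieldOp_eq, covVecFieldOp_eq, h hk,
    (h.eventuallyEq_of_mem (hU.mem_nhds hk)).fderiv_eq]

lemma covVecFieldOp_add {Xe : (Fin N → ℝ) → Fin N → Fin N → ℝ} {B : Matrix (Fin N) (Fin N) ℝ}
    (A : Fin N) {f g : (Fin N → ℝ) → ℝ} {k : Fin N → ℝ}
    (hf : DifferentiableAt ℝ f k) (hg : DifferentiableAt ℝ g k) :
    covVecFieldOp Xe B A (fun q => f q + g q) k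
      = covVecFieldOp Xe B A f k + covVecFieldOp Xe B A g k := by
  simp only [covVecFieldOp_eq, fderiv_fun_add hf hg, _root_.add_apply]
  ring

lemma covVecFieldOp_const_mul {Xe : (Fin N → ℝ) → Fin N → Fin N → ℝ}
    {B : Matrix (Fin N) (Fin N) ℝ} (A : Fin N) {f : (Fin N → ℝ) → ℝ} {k : Fin N → ℝ} (c : ℝ)
    (hf : DifferentiableAt ℝ f k) :
    covVecFieldOp Xe B A (fun q => c * f q) k = c * covVecFieldOp Xe B A f k := by
  simp only [covVecFieldOp_eq, fderiv_const_mul hf, _root_.smul_apply, smul_eq_mul]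
  ring

lemma covVecFieldOp_sum {Xe : (Fin N → ℝ) → Fin N → Fin N → ℝ} {B : Matrix (Fin N) (Fin N) ℝ}
    (A : Fin N) {ι : Type*} [Fintype ι] (c : ι → ℝ) {g : ι → (Fin N → ℝ) → ℝ} {k : Fin N → ℝ}
    (hg : ∀ i, DifferentiableAt ℝ (g i) k) :
    covVecFieldOp Xe B A (fun q => ∑ i, c i * g i q) k
      = ∑ i, c i * covVecFieldOp Xe B A (g i) k := by
  simp only [covVecFieldOp_eq]
  rw [fderiv_fun_sum fun i _ => (hg i).const_mul (c i)]
  simp only [_root_.sum_apply, fderiv_const_mul (hg _), _root_.smul_apply, smul_eq_mul,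
    mul_sub, Finset.sum_sub_distrib, Finset.mul_sum]
  congr 1
  exact Finset.sum_congr rfl fun i _ => by ring

/-- The commutator with the Casimir operator follows from the commutators of the `J_A`. -/
lemma covCasimirOp_commutator {U : Set (Fin N → ℝ)} (hU : IsOpen U)
    {Xe : (Fin N → ℝ) → Fin N → Fin N → ℝ} {B : Matrix (Fin N) (Fin N) ℝ}
    (C : Fin N → Fin N → Fin N → ℝ) (η : Matrix (Fin N) (Fin N) ℝ) (hη : ∀ A A', η A A' = η A' A)
    (hinv : ∀ A P Q, ∑ D, (C P A D * η D Q + η P D * C Q A D) = 0)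
    (hsmooth : ∀ A (f : (Fin N → ℝ) → ℝ), ContDiffOn ℝ (⊤ : ℕ∞) f U →
      ContDiffOn ℝ (⊤ : ℕ∞) (covVecFieldOp Xe B A f) U)
    (hcomm : ∀ f : (Fin N → ℝ) → ℝ, ContDiffOn ℝ (⊤ : ℕ∞) f U → ∀ A B', ∀ k ∈ U,
      covVecFieldOp Xe B A (covVecFieldOp Xe B B' f) k
          - covVecFieldOp Xe B B' (covVecFieldOp Xe B A f) k
        = (∑ C', C C' A B' * covVecFieldOp Xe B C' f k) + B A B' * f k)
    {f : (Fin N → ℝ) → ℝ} (hf : ContDiffOn ℝ (⊤ : ℕ∞) f U) (A : Fin N) {k : Fin N → ℝ}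
    (hk : k ∈ U) :
    covVecFieldOp Xe B A (covCasimirOp η Xe B f) k
        - covCasimirOp η Xe B (covVecFieldOp Xe B A f) k
      = 2 * ∑ B', ∑ C', B A B' * η B' C' * covVecFieldOp Xe B C' f k := by
  have hd : ∀ {g : (Fin N → ℝ) → ℝ}, ContDiffOn ℝ (⊤ : ℕ∞) g U → DifferentiableAt ℝ g k :=
    fun hg => (hg.contDiffAt (hU.mem_nhds hk)).differentiableAt (by simp)
  set J := covVecFieldOp Xe B with hJ
  have h1 : J A (covCasimirOp η Xe B f) k = ∑ P, ∑ Q, η P Q * J A (J P (J Q f)) k := by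
    have : covCasimirOp η Xe B f = fun q => ∑ p : Fin N × Fin N, η p.1 p.2 * J p.1 (J p.2 f) q := by
      funext q
      rw [Fintype.sum_prod_type]
      rfl
    rw [this, hJ, covVecFieldOp_sum, Fintype.sum_prod_type]
    exact fun p => hd (hsmooth _ _ (hsmooth _ _ hf))
  have h2 : ∀ P Q, J P (J Q (J A f)) k = J P (J A (J Q f)) k
      - ((∑ D, C D A Q * J P (J D f) k) + B A Q * J P f k) := by
    intro P Q
    have e : Set.EqOn (J A (J Q f))
        (fun q => J Q (J A f) q + ((∑ D, C D A Q * J D f q) + B A Q * f q)) U := fun q hq => by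
      have := hcomm f hf A Q q hq
      simp only
      linarith
    have hs : DifferentiableAt ℝ (fun q => ∑ D, C D A Q * J D f q) k :=
      DifferentiableAt.fun_sum fun D _ => (hd (hsmooth D f hf)).const_mul _
    have hs' : DifferentiableAt ℝ (fun q => B A Q * f q) k := (hd hf).const_mul (B A Q)
    have := covVecFieldOp_congr (Xe := Xe) (B := B) hU P e hk
    rw [covVecFieldOp_add P (hd (hsmooth _ _ (hsmooth _ _ hf))) (hs.fun_add hs'),
      covVecFieldOp_add P hs hs', covVecFieldOp_sum P _ fun D => hd (hsmooth D f hf),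
      covVecFieldOp_const_mul P _ (hd hf)] at this
    rw [← hJ] at this
    linarith
  have h3 : ∀ P Q, J A (J P (J Q f)) k - J P (J A (J Q f)) k
      = (∑ D, C D A P * J D (J Q f) k) + B A P * J Q f k := fun P Q =>
    hcomm _ (hsmooth Q f hf) A P k hk
  have h4 : covCasimirOp η Xe B (J A f) k = ∑ P, ∑ Q, η P Q * J P (J Q (J A f)) k := rfl
  rw [h1, h4, ← Finset.sum_sub_distrib]
  have h5 : ∀ P, (∑ Q, η P Q * J A (J P (J Q f)) k) - ∑ Q, η P Q * J P (J Q (J A f)) k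
      = (∑ Q, ∑ D, η P Q * C D A P * J D (J Q f) k)
        + (∑ Q, ∑ D, η P Q * C D A Q * J P (J D f) k)
        + (∑ Q, B A P * η P Q * J Q f k) + ∑ Q, B A Q * η Q P * J P f k := by
    intro P
    simp only [← Finset.sum_sub_distrib, ← Finset.sum_add_distrib]
    refine Finset.sum_congr rfl fun Q _ => ?_
    have e1 : ∑ D, η P Q * C D A P * J D (J Q f) k = η P Q * ∑ D, C D A P * J D (J Q f) k := by
      rw [Finset.mul_sum]; exact Finset.sum_congr rfl fun _ _ => by ring
    have e2 : ∑ D, η P Q * C D A Q * J P (J D f) k = η P Q * ∑ D, C D A Q * J P (J D f) k := by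
      rw [Finset.mul_sum]; exact Finset.sum_congr rfl fun _ _ => by ring
    rw [Finset.sum_add_distrib, e1, e2, h2, hη Q P]
    linear_combination η P Q * h3 P Q
  simp only [h5, Finset.sum_add_distrib]
  have h6 : (∑ P, ∑ Q, ∑ D, η P Q * C D A P * J D (J Q f) k)
      + (∑ P, ∑ Q, ∑ D, η P Q * C D A Q * J P (J D f) k) = 0 := by
    have e1 : (∑ P, ∑ Q, ∑ D, η P Q * C D A P * J D (J Q f) k)
        = ∑ P, ∑ Q, ∑ D, η D Q * C P A D * J P (J Q f) k := by
      rw [Finset.sum_comm]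
      rw [Finset.sum_comm (s := (Finset.univ : Finset (Fin N)))
        (f := fun P Q => ∑ D, η D Q * C P A D * J P (J Q f) k)]
      exact Finset.sum_congr rfl fun Q _ => Finset.sum_comm
    have e2 : (∑ P, ∑ Q, ∑ D, η P Q * C D A Q * J P (J D f) k)
        = ∑ P, ∑ Q, ∑ D, η P D * C Q A D * J P (J Q f) k :=
      Finset.sum_congr rfl fun P _ => Finset.sum_comm
    rw [e1, e2]
    simp only [← Finset.sum_add_distrib]
    refine Finset.sum_eq_zero fun P _ => Finset.sum_eq_zero fun Q _ => ?_
    rw [← zero_mul (J P (J Q f) k), ← hinv A P Q, Finset.sum_mul]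
    exact Finset.sum_congr rfl fun D _ => by ring
  have h7 : (∑ P, ∑ Q, B A Q * η Q P * J P f k) = ∑ P, ∑ Q, B A P * η P Q * J Q f k :=
    Finset.sum_comm
  rw [h6, h7]
  ring

end Operators

/-- The operators `J_A` satisfy `[J_A,J_B] = C^C_{AB} J_C + B_{AB}` and
`[J_A,J²] = 2 B_{AB} γ^{BC} J_C` on `U = {k : Y(k) invertible}`. -/
theorem covariant_fields_commutation
    (N : ℕ)
    (C : Fin N → Fin N → Fin N → ℝ)
    (hCanti : ∀ A B C', C A B C' = -C A C' B)
    (CM : Fin N → Matrix (Fin N) (Fin N) ℝ)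
    (hCM : ∀ A B C', CM A B C' = C B A C')
    (hCC : ∀ A B, CM A * CM B - CM B * CM A = ∑ C', C C' A B • CM C')
    (γ : Matrix (Fin N) (Fin N) ℝ)
    (hγsymm : γᵀ = γ) (hγinv : IsUnit γ)
    (hγC : ∀ A C' D', ∑ B, (γ A B * C B C' D' + γ D' B * C B C' A) = 0)
    (B : Matrix (Fin N) (Fin N) ℝ)
    (hBanti : Bᵀ = -B)
    (hCB : ∀ B' C' D', ∑ A, C A B' C' * B A D' = 0)
    (Y : (Fin N → ℝ) → Matrix (Fin N) (Fin N) ℝ)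
    (hY : ∀ k, Y k =
      ∑' j : ℕ, ((-1 : ℝ) ^ j / (Nat.factorial (j + 1))) • (∑ A, k A • CM A) ^ j)
    (U : Set (Fin N → ℝ))
    (hU : U = {k | IsUnit (Y k)})
    (Xe : (Fin N → ℝ) → Fin N → Fin N → ℝ)
    (hXe : ∀ k A M, Xe k A M = (Y k)⁻¹ M A) :
    ∀ f : (Fin N → ℝ) → ℝ, ContDiffOn ℝ (⊤ : ℕ∞) f U →
      (∀ A B', ∀ k ∈ U,
        covVecFieldOp Xe B A (covVecFieldOp Xe B B' f) k
          - covVecFieldOp Xe B B' (covVecFieldOp Xe B A f) k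
        = (∑ C', C C' A B' * covVecFieldOp Xe B C' f k) + B A B' * f k) ∧
      (∀ A, ∀ k ∈ U,
        covVecFieldOp Xe B A (covCasimirOp γ⁻¹ Xe B f) k
          - covCasimirOp γ⁻¹ Xe B (covVecFieldOp Xe B A f) k
        = 2 * ∑ B', ∑ C', B A B' * γ⁻¹ B' C' * covVecFieldOp Xe B C' f k) := by
  have hYe : ∀ k, Y k = expQuot (matComb CM k) := hY
  have hUe : U = {k | IsUnit (expQuot (matComb CM k))} := by simp only [hU, hYe]
  have hUo : IsOpen U := hUe ▸ isOpen_isUnit_expQuot CM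
  have hXv : ∀ A, (fun k M => Xe k A M)
      = fun k => (expQuot (matComb CM k))⁻¹ *ᵥ Pi.single A 1 := fun A => by
    funext k M
    simp [hXe, hYe]
  have hXk : ∀ A k, (fun M => Xe k A M) = (expQuot (matComb CM k))⁻¹ *ᵥ Pi.single A 1 :=
    fun A k => congrFun (hXv A) k
  have hmv : ∀ a b P, (matComb CM a *ᵥ b) P = ∑ A, ∑ D, C P A D * a A * b D := fun a b P => by
    simp only [matComb_apply, mulVec, dotProduct, Matrix.sum_apply, Matrix.smul_apply, hCM,
      Finset.sum_mul, smul_eq_mul]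
    rw [Finset.sum_comm]
    exact Finset.sum_congr rfl fun _ _ => Finset.sum_congr rfl fun _ _ => by ring
  have hanti : ∀ a b, matComb CM a *ᵥ b = -(matComb CM b *ᵥ a) := fun a b => by
    funext P
    rw [Pi.neg_apply, hmv, hmv, Finset.sum_comm]
    simp only [← Finset.sum_neg_distrib]
    exact Finset.sum_congr rfl fun D _ => Finset.sum_congr rfl fun A _ => by
      rw [hCanti P A D]; ring
  have hjac : ∀ a b, matComb CM (matComb CM a *ᵥ b)
      = matComb CM a * matComb CM b - matComb CM b * matComb CM a := fun a b => by
    have e : matComb CM a * matComb CM b - matComb CM b * matComb CM a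
        = ∑ A, ∑ D, (a A * b D) • (CM A * CM D - CM D * CM A) := by
      simp only [matComb_apply, Finset.sum_mul_sum, smul_sub, Finset.sum_sub_distrib,
        smul_mul_smul_comm]
      rw [Finset.sum_comm (f := fun D A => (b D * a A) • (CM D * CM A))]
      simp only [mul_comm (b _) (a _)]
    rw [e, matComb_apply]
    simp only [hmv, hCC, Finset.smul_sum, Finset.sum_smul, smul_smul]
    rw [Finset.sum_comm]
    refine Finset.sum_congr rfl fun A _ => ?_
    rw [Finset.sum_comm]
    exact Finset.sum_congr rfl fun D _ => Finset.sum_congr rfl fun P _ => by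
      congr 1; ring
  have hBC : ∀ a, B * matComb CM a = 0 := fun a => by
    have h0 : ∀ P, B * CM P = 0 := fun P => by
      ext A D
      have h1 : ∀ Q, B A Q = -B Q A := fun Q => congrFun (congrFun hBanti Q) A
      simp only [mul_apply, h1, hCM, neg_mul, Finset.sum_neg_distrib, Matrix.zero_apply,
        neg_eq_zero]
      simpa only [mul_comm] using hCB P D A
    simp [matComb_apply, Finset.mul_sum, h0]
  have hBx : ∀ A D, ∀ k ∈ U, rowForm B A (fun M => Xe k D M) = B A D := fun A D k hk => by
    rw [hUe] at hk
    have h1 : B * (expQuot (matComb CM k))⁻¹ = B := by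
      conv_lhs => rw [← mul_expQuot_of_mul_eq_zero (hBC k)]
      rw [mul_assoc, mul_nonsing_inv _ ((isUnit_iff_isUnit_det _).1 hk), mul_one]
    rw [hXk]
    change (B *ᵥ _) A = _
    rw [mulVec_mulVec, h1]
    simp
  have hXs : ∀ A, ∀ k ∈ U, ContDiffAt ℝ (⊤ : ℕ∞) (fun k M => Xe k A M) k := fun A k hk => by
    rw [hXv]
    exact contDiffAt_expQuot_inv_mulVec CM (by rwa [hUe] at hk) _
  have hop : ∀ A f, covVecFieldOp Xe B A f
      = fun k => fderiv ℝ f k (fun M => Xe k A M) - 1 / 2 * rowForm B A k * f k := fun A f =>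
    funext fun k => covVecFieldOp_eq Xe B A f k
  have hsmooth : ∀ A (f : (Fin N → ℝ) → ℝ), ContDiffOn ℝ (⊤ : ℕ∞) f U →
      ContDiffOn ℝ (⊤ : ℕ∞) (covVecFieldOp Xe B A f) U := by
    intro A f hf
    rw [hop]
    exact ((hf.fderiv_of_isOpen hUo (by simp)).clm_apply
      fun k hk => (hXs A k hk).contDiffWithinAt).sub
        ((contDiffOn_const.mul (rowForm B A).contDiff.contDiffOn).mul hf)
  have hcomm : ∀ f : (Fin N → ℝ) → ℝ, ContDiffOn ℝ (⊤ : ℕ∞) f U → ∀ A B', ∀ k ∈ U,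
      covVecFieldOp Xe B A (covVecFieldOp Xe B B' f) k
          - covVecFieldOp Xe B B' (covVecFieldOp Xe B A f) k
        = (∑ C', C C' A B' * covVecFieldOp Xe B C' f k) + B A B' * f k := by
    intro f hf A D k hk
    have hfk : ContDiffAt ℝ 2 f k :=
      (hf.contDiffAt (hUo.mem_nhds hk)).of_le (WithTop.coe_le_coe.2 le_top)
    have hx := fun A => (hXs A k hk).differentiableAt (by simp)
    have h1 := firstOrder_commutator (rowForm B A) (rowForm B D) hfk (hx A) (hx D)
    simp only [hop] at h1 ⊢
    rw [h1, hBx _ _ k hk, hBx _ _ k hk, hXv, hXv]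
    have h2 := bracket_expQuot_inv_mulVec CM hanti hjac (k := k) (by rwa [hUe] at hk)
      (Pi.single A 1) (Pi.single D 1)
    have h3 : matComb CM (Pi.single A 1) *ᵥ Pi.single D 1
        = ∑ P, C P A D • (Pi.single P 1 : Fin N → ℝ) := by
      funext Q
      rw [hmv]
      simp [Pi.single_apply, Finset.sum_apply]
    have h4 : ∑ P, C P A D * rowForm B P k = 0 := by
      have e : ∀ P, rowForm B P k = ∑ Q, B P Q * k Q := fun P => rfl
      simp only [e, Finset.mul_sum]
      rw [Finset.sum_comm]
      refine Finset.sum_eq_zero fun Q _ => ?_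
      rw [← zero_mul (k Q), ← hCB A D Q, Finset.sum_mul]
      exact Finset.sum_congr rfl fun _ _ => by ring
    have h5 : B D A = -B A D := congrFun (congrFun hBanti A) D
    have h6 : ∑ P, C P A D * (1 / 2 * rowForm B P k * f k) = 0 := by
      rw [← mul_zero (1 / 2 * f k), ← h4, Finset.mul_sum]
      exact Finset.sum_congr rfl fun _ _ => by ring
    simp only [hXk]
    rw [h2, h3, mulVec_sum, map_sum]
    simp only [mulVec_smul, map_smul, smul_eq_mul, mul_sub, Finset.sum_sub_distrib, h6, h5]
    ring
  intro f hf
  refine ⟨hcomm f hf, fun A k hk =>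
    covCasimirOp_commutator hUo C γ⁻¹ ?_ ?_ hsmooth hcomm hf A hk⟩
  · intro A A'
    have h : (γ⁻¹)ᵀ = γ⁻¹ := by rw [transpose_nonsing_inv, hγsymm]
    exact congrFun (congrFun h A') A
  · intro A P Q
    have hdet := (isUnit_iff_isUnit_det _).1 hγinv
    have h1 : (CM A)ᵀ * γ = -(γ * CM A) := by
      rw [← hγsymm, ← transpose_mul, hγsymm]
      ext E F
      rw [transpose_apply, Matrix.neg_apply, eq_neg_iff_add_eq_zero, add_comm]
      simpa only [mul_apply, hCM, Finset.sum_add_distrib] using hγC E A F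
    have h2 : CM A * γ⁻¹ + γ⁻¹ * (CM A)ᵀ = 0 := by
      have h3 : γ⁻¹ * ((CM A)ᵀ * γ) * γ⁻¹ = γ⁻¹ * -(γ * CM A) * γ⁻¹ := by rw [h1]
      rw [mul_assoc, mul_assoc, mul_nonsing_inv _ hdet, mul_one, mul_neg, ← mul_assoc,
        nonsing_inv_mul _ hdet, one_mul, neg_mul] at h3
      rw [h3, add_neg_cancel]
    have h4 : _ = (0 : ℝ) := congrFun (congrFun h2 P) Q
    simpa only [Matrix.add_apply, mul_apply, transpose_apply, hCM, Finset.sum_add_distrib] using h4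
end

section
/- Let M and B be real N×N matrices with MB = BM = 0, and define sinhc(X) := Σ_{j≥0} X^{2j}/(2j+1)! for a square matrix X (the analytic matrix function sinh(X)/X). Then sinhc(M + B) = sinhc(M) · sinhc(B); in particular, det sinhc(M + B) = det sinhc(M) · det sinhc(B). -/
open Matrix

/-- The analytic matrix function `sinh(X)/X = Σ_{j≥0} X^{2j}/(2j+1)!`. -/
noncomputable def matSinhc {N : ℕ} (X : Matrix (Fin N) (Fin N) ℝ) : Matrix (Fin N) (Fin N) ℝ :=
  ∑' j : ℕ, ((1 : ℝ) / (Nat.factorial (2 * j + 1))) • X ^ (2 * j)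

theorem add_pow_succ_of_mul_eq_zero {R : Type*} [Semiring R] {a b : R}
    (hab : a * b = 0) (hba : b * a = 0) (n : ℕ) :
    (a + b) ^ (n + 1) = a ^ (n + 1) + b ^ (n + 1) := by
  induction n with
  | zero => simp
  | succ n ih =>
    rw [pow_succ, ih, add_mul, mul_add, mul_add, pow_succ a n, pow_succ b n, mul_assoc _ a b,
      mul_assoc _ b a, hab, hba, mul_zero, mul_zero, add_zero, zero_add, ← pow_succ, ← pow_succ,
      ← pow_succ, ← pow_succ]

section

attribute [local instance] Matrix.linftyOpNormedRing Matrix.linftyOpNormedAlgebra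

theorem summable_matSinhc {N : ℕ} (X : Matrix (Fin N) (Fin N) ℝ) :
    Summable fun j : ℕ => ((1 : ℝ) / (Nat.factorial (2 * j + 1))) • X ^ (2 * j) := by
  have h : Summable fun j : ℕ => ‖((2 * j).factorial⁻¹ : ℝ) • X ^ (2 * j)‖ :=
    (NormedSpace.norm_expSeries_summable' (𝕂 := ℝ) X).comp_injective
      (mul_right_injective₀ (two_ne_zero' ℕ))
  refine Summable.of_norm_bounded h fun j => ?_
  rw [norm_smul, norm_smul, one_div]
  refine mul_le_mul_of_nonneg_right ?_ (norm_nonneg _)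
  rw [Real.norm_of_nonneg (by positivity), Real.norm_of_nonneg (by positivity)]
  gcongr
  omega

end

theorem summable_matSinhc_tail {N : ℕ} (X : Matrix (Fin N) (Fin N) ℝ) :
    Summable fun j : ℕ =>
      ((1 : ℝ) / (Nat.factorial (2 * (j + 1) + 1))) • X ^ (2 * (j + 1)) :=
  (summable_nat_add_iff 1).2 (summable_matSinhc X)

theorem matSinhc_eq_one_add_tail {N : ℕ} (X : Matrix (Fin N) (Fin N) ℝ) :
    matSinhc X = 1 +
      ∑' j : ℕ, ((1 : ℝ) / (Nat.factorial (2 * (j + 1) + 1))) • X ^ (2 * (j + 1)) := by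
  rw [matSinhc, (summable_matSinhc X).tsum_eq_zero_add]
  simp

/-- If `MB = BM = 0`, then `sinhc(M+B) = sinhc(M)·sinhc(B)`, and in particular
`det sinhc(M+B) = det sinhc(M) · det sinhc(B)`. -/
theorem sinhc_add_of_mul_eq_zero
    (N : ℕ) (M B : Matrix (Fin N) (Fin N) ℝ)
    (hMB : M * B = 0) (hBM : B * M = 0) :
    matSinhc (M + B) = matSinhc M * matSinhc B ∧
    (matSinhc (M + B)).det = (matSinhc M).det * (matSinhc B).det := by
  have h : matSinhc (M + B) = matSinhc M * matSinhc B := by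
    have hM := summable_matSinhc_tail M
    have hB := summable_matSinhc_tail B
    have hprod : (∑' j : ℕ, ((1 : ℝ) / (Nat.factorial (2 * (j + 1) + 1))) • M ^ (2 * (j + 1))) *
        ∑' k : ℕ, ((1 : ℝ) / (Nat.factorial (2 * (k + 1) + 1))) • B ^ (2 * (k + 1)) = 0 := by
      rw [← hM.tsum_mul_right, ← tsum_zero (β := ℕ)]
      refine tsum_congr fun j => ?_
      rw [← hB.tsum_mul_left, ← tsum_zero (β := ℕ)]
      refine tsum_congr fun k => ?_
      rw [smul_mul_smul_comm, show 2 * (j + 1) = 2 * j + 1 + 1 by ring,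
        show 2 * (k + 1) = 2 * k + 1 + 1 by ring, pow_succ M, pow_succ' B, mul_assoc,
        ← mul_assoc M, hMB, zero_mul, mul_zero, smul_zero]
    have hadd : ∀ j : ℕ, (M + B) ^ (2 * (j + 1)) = M ^ (2 * (j + 1)) + B ^ (2 * (j + 1)) :=
      fun j => add_pow_succ_of_mul_eq_zero hMB hBM (2 * j + 1)
    simp only [matSinhc_eq_one_add_tail, hadd, smul_add]
    rw [hM.tsum_add hB, add_mul, mul_add, mul_add, hprod, one_mul, one_mul, mul_one, add_zero]
    abel
  exact ⟨h, by rw [h, det_mul]⟩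
end
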